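/- arXiv:2509.18857 — 2 statements merged into one kernel-verified Lean document; each statement's English description precedes it below -/
import Mathlib

section
/- Assume ‖R₁‖ ≤ ‖R₂‖ ≤ … ≤ ‖Rₙ‖. Then min_{w ∈ W} max_{θ ∈ Θ} MSE(w,θ) = min_{w ∈ W₀} max_{θ ∈ Θ} MSE(w,θ), where W₀ = {w ∈ W : w₁ ≥ w₂ ≥ … ≥ wₙ}; all minima and maxima exist since W, W₀ and Θ are compact and MSE is continuous. -/
/- STATEMENT 4 (Lemma lem:monotone): under ‖R₁‖ ≤ … ≤ ‖Rₙ‖,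
   min_{w ∈ W} max_{θ ∈ Θ} MSE(w,θ) = min_{w ∈ W₀} max_{θ ∈ Θ} MSE(w,θ),
   where W₀ is the set of nonincreasing weight vectors in W. -/

open Finset

/-- The weight set `W = {w ∈ ℝⁿ : ∑ wᵢ ≤ 1, wᵢ ≥ 0}`. -/
def Wset (n : ℕ) : Set (Fin n → ℝ) :=
  {w | (∑ i, w i) ≤ 1 ∧ ∀ i, 0 ≤ w i}

/-- The parameter set `Θ` (Lipschitz class with values in [-1/2,1/2]). -/
def ThetaSet {E : Type*} [NormedAddCommGroup E] (n : ℕ) (C : ℝ)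
    (R : Fin (n + 1) → E) : Set (Fin (n + 1) → ℝ) :=
  {θ | (∀ i, θ i ∈ Set.Icc (-(1 / 2) : ℝ) (1 / 2)) ∧
    ∀ i j, |θ i - θ j| ≤ C * ‖R i - R j‖}

/-- The mean squared error of the linear-shrinkage estimator with weights `w`. -/
noncomputable def MSE (n : ℕ) (w : Fin n → ℝ) (θ : Fin (n + 1) → ℝ) : ℝ :=
  (∑ i, w i * θ i.succ - θ 0) ^ 2 + ∑ i, (w i) ^ 2 * (1 / 4 - (θ i.succ) ^ 2)

theorem isCompact_Wset (n : ℕ) : IsCompact (Wset n) := by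
  have hsub : Wset n ⊆ Set.Icc 0 1 := fun w hw =>
    ⟨hw.2, fun i => (Finset.single_le_sum (fun k _ => hw.2 k) (Finset.mem_univ i)).trans hw.1⟩
  have hclosed : IsClosed (Wset n) := by
    simp only [Wset, Set.ofPred_and, Set.ofPred_forall]
    exact (isClosed_le (by fun_prop) (by fun_prop)).inter
      (isClosed_iInter fun i => isClosed_le (by fun_prop) (by fun_prop))
  exact isCompact_Icc.of_isClosed_subset hclosed hsub

theorem isCompact_ThetaSet {E : Type*} [NormedAddCommGroup E] (n : ℕ) (C : ℝ)
    (R : Fin (n + 1) → E) : IsCompact (ThetaSet n C R) := by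
  have hsub : ThetaSet n C R ⊆ Set.Icc (fun _ => -(1 / 2)) (fun _ => 1 / 2) := fun θ hθ =>
    ⟨fun i => (hθ.1 i).1, fun i => (hθ.1 i).2⟩
  have hclosed : IsClosed (ThetaSet n C R) := by
    simp only [ThetaSet, Set.ofPred_and, Set.ofPred_forall, Set.mem_Icc]
    exact (isClosed_iInter fun i => (isClosed_le (by fun_prop) (by fun_prop)).inter
      (isClosed_le (by fun_prop) (by fun_prop))).inter
      (isClosed_iInter fun i => isClosed_iInter fun j =>
        isClosed_le (by fun_prop) (by fun_prop))
  exact isCompact_Icc.of_isClosed_subset hclosed hsub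

theorem continuous_MSE (n : ℕ) :
    Continuous fun p : (Fin n → ℝ) × (Fin (n + 1) → ℝ) => MSE n p.1 p.2 := by
  unfold MSE
  fun_prop

/-- The parameter decreasing from `t` at rate `C` in the norm, truncated below at `-1/2`. -/
noncomputable def radialParam {E : Type*} [NormedAddCommGroup E] {n : ℕ} (C : ℝ)
    (R : Fin (n + 1) → E) (t : ℝ) (k : Fin (n + 1)) : ℝ :=
  max (t - C * ‖R k‖) (-(1 / 2))

theorem radialParam_mem_ThetaSet {E : Type*} [NormedAddCommGroup E] {n : ℕ} {C : ℝ}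
    (hC : 0 ≤ C) (R : Fin (n + 1) → E) {t : ℝ} (ht : t ≤ 1 / 2) :
    radialParam C R t ∈ ThetaSet n C R := by
  refine ⟨fun i => ⟨le_max_right _ _, max_le ?_ (by norm_num)⟩, fun i j => ?_⟩
  · have := mul_nonneg hC (norm_nonneg (R i))
    linarith
  · refine (abs_max_sub_max_le_abs _ _ _).trans ?_
    have h : t - C * ‖R i‖ - (t - C * ‖R j‖) = C * (‖R j‖ - ‖R i‖) := by ring
    rw [h, abs_mul, abs_of_nonneg hC, abs_sub_comm]
    exact mul_le_mul_of_nonneg_left (abs_norm_sub_norm_le _ _) hC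

theorem sq_sum_sub_sum_sq_le {ι : Type*} (s : Finset ι) {x y : ι → ℝ}
    (h : ∀ i ∈ s, |x i| ≤ y i) :
    (∑ i ∈ s, x i) ^ 2 - ∑ i ∈ s, x i ^ 2 ≤ (∑ i ∈ s, y i) ^ 2 - ∑ i ∈ s, y i ^ 2 := by
  have hp : ∀ i ∈ s, 0 ≤ y i - x i := fun i hi => by linarith [(abs_le.1 (h i hi)).2]
  have hq : ∀ i ∈ s, 0 ≤ y i + x i := fun i hi => by linarith [(abs_le.1 (h i hi)).1]
  have key : ∑ i ∈ s, (y i - x i) * (y i + x i)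
      ≤ (∑ i ∈ s, (y i - x i)) * ∑ i ∈ s, (y i + x i) := by
    rw [Finset.sum_mul]
    exact Finset.sum_le_sum fun i hi =>
      mul_le_mul_of_nonneg_left (Finset.single_le_sum hq hi) (hp i hi)
  have e : ∑ i ∈ s, (y i - x i) * (y i + x i) = ∑ i ∈ s, y i ^ 2 - ∑ i ∈ s, x i ^ 2 := by
    rw [← Finset.sum_sub_distrib]
    exact Finset.sum_congr rfl fun i _ => by ring
  rw [e, Finset.sum_sub_distrib, Finset.sum_add_distrib] at key
  linarith

/-- The mean squared error in terms of the deviations `θ i - θ 0`. -/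
theorem MSE_eq_deviations (n : ℕ) (w : Fin n → ℝ) (θ : Fin (n + 1) → ℝ) :
    MSE n w θ = ((∑ i, w i * (θ i.succ - θ 0)) ^ 2 - ∑ i, (w i * (θ i.succ - θ 0)) ^ 2)
      + 2 * ∑ i, ((1 - ∑ k, w k) * w i + w i ^ 2) * (-(θ 0) * (θ i.succ - θ 0))
      + ((1 - ∑ k, w k) ^ 2 * θ 0 ^ 2 + (∑ i, w i ^ 2) * (1 / 4 - θ 0 ^ 2)) := by
  unfold MSE
  set S := ∑ k, w k with hS
  have e1 : ∑ i, w i * θ i.succ = ∑ i, w i * (θ i.succ - θ 0) + S * θ 0 := by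
    rw [hS, Finset.sum_mul, ← Finset.sum_add_distrib]
    exact Finset.sum_congr rfl fun i _ => by ring
  have e2 : ∑ i, ((1 - S) * w i + w i ^ 2) * (-(θ 0) * (θ i.succ - θ 0))
      = -(θ 0) * (1 - S) * ∑ i, w i * (θ i.succ - θ 0)
        - θ 0 * ∑ i, w i ^ 2 * (θ i.succ - θ 0) := by
    rw [Finset.mul_sum, Finset.mul_sum, ← Finset.sum_sub_distrib]
    exact Finset.sum_congr rfl fun i _ => by ring
  have e3 : ∑ i, w i ^ 2 * (1 / 4 - θ i.succ ^ 2)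
      = (∑ i, w i ^ 2) * (1 / 4 - θ 0 ^ 2) - 2 * θ 0 * ∑ i, w i ^ 2 * (θ i.succ - θ 0)
        - ∑ i, (w i * (θ i.succ - θ 0)) ^ 2 := by
    rw [Finset.mul_sum, Finset.sum_mul, ← Finset.sum_sub_distrib, ← Finset.sum_sub_distrib]
    exact Finset.sum_congr rfl fun i _ => by ring
  rw [e1, e2, e3]
  ring

theorem radialParam_zero {E : Type*} [NormedAddCommGroup E] {n : ℕ} (C : ℝ)
    {R : Fin (n + 1) → E} (hR0 : R 0 = 0) {t : ℝ} (ht : 0 ≤ t) :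
    radialParam C R t 0 = t := by
  rw [radialParam, hR0, norm_zero, mul_zero, sub_zero]
  exact max_eq_left (by linarith)

theorem MSE_le_MSE_radialParam {E : Type*} [NormedAddCommGroup E] {n : ℕ} {C : ℝ}
    {R : Fin (n + 1) → E} (hR0 : R 0 = 0) {w : Fin n → ℝ} (hw : w ∈ Wset n)
    {θ : Fin (n + 1) → ℝ} (hθ : θ ∈ ThetaSet n C R) :
    MSE n w θ ≤ MSE n w (radialParam C R |θ 0|) := by
  have hdev : ∀ i : Fin n, |θ i.succ - θ 0| ≤ |θ 0| - radialParam C R |θ 0| i.succ := by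
    intro i
    rw [le_sub_comm]
    refine max_le ?_ ?_
    · have := hθ.2 i.succ 0
      rw [hR0, sub_zero] at this
      linarith
    · have h1 := abs_sub (θ i.succ) (θ 0)
      have h2 : |θ i.succ| ≤ 1 / 2 := abs_le.2 (hθ.1 i.succ)
      linarith
  rw [MSE_eq_deviations, MSE_eq_deviations n w (radialParam C R |θ 0|),
    radialParam_zero C hR0 (abs_nonneg _), sq_abs]
  have h1 : (∑ i, w i * (θ i.succ - θ 0)) ^ 2 - ∑ i, (w i * (θ i.succ - θ 0)) ^ 2
      ≤ (∑ i, w i * (radialParam C R |θ 0| i.succ - |θ 0|)) ^ 2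
        - ∑ i, (w i * (radialParam C R |θ 0| i.succ - |θ 0|)) ^ 2 := by
    have := sq_sum_sub_sum_sq_le Finset.univ
      (x := fun i => w i * (θ i.succ - θ 0))
      (y := fun i => -(w i * (radialParam C R |θ 0| i.succ - |θ 0|)))
      (fun i _ => by
        rw [abs_mul, abs_of_nonneg (hw.2 i), ← mul_neg, neg_sub]
        exact mul_le_mul_of_nonneg_left (hdev i) (hw.2 i))
    simpa only [Finset.sum_neg_distrib, neg_sq] using this
  have h2 : ∑ i, ((1 - ∑ k, w k) * w i + w i ^ 2) * (-(θ 0) * (θ i.succ - θ 0))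
      ≤ ∑ i, ((1 - ∑ k, w k) * w i + w i ^ 2)
          * (-|θ 0| * (radialParam C R |θ 0| i.succ - |θ 0|)) := by
    refine Finset.sum_le_sum fun i _ => mul_le_mul_of_nonneg_left ?_ ?_
    · calc -(θ 0) * (θ i.succ - θ 0) ≤ |-(θ 0) * (θ i.succ - θ 0)| := le_abs_self _
        _ = |θ 0| * |θ i.succ - θ 0| := by rw [abs_mul, abs_neg]
        _ ≤ |θ 0| * (|θ 0| - radialParam C R |θ 0| i.succ) :=
          mul_le_mul_of_nonneg_left (hdev i) (abs_nonneg _)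
        _ = _ := by ring
    · exact add_nonneg (mul_nonneg (sub_nonneg.2 hw.1) (hw.2 i)) (sq_nonneg _)
  linarith

/-- Replace the weights at `i` and `j` by their mean. -/
noncomputable def averagePair {n : ℕ} (w : Fin n → ℝ) (i j : Fin n) : Fin n → ℝ :=
  fun k => if k = i ∨ k = j then (w i + w j) / 2 else w k

theorem sum_averagePair {n : ℕ} (f : Fin n → ℝ → ℝ) (w : Fin n → ℝ) {i j : Fin n}
    (hij : i ≠ j) :
    ∑ k, f k (averagePair w i j k) = ∑ k, f k (w k)
      + (f i ((w i + w j) / 2) - f i (w i)) + (f j ((w i + w j) / 2) - f j (w j)) := by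
  have h := Fintype.sum_eq_add (f := fun k => f k (averagePair w i j k) - f k (w k)) i j hij
    (fun k hk => by simp [averagePair, hk.1, hk.2])
  rw [Finset.sum_sub_distrib] at h
  simp only [averagePair, true_or, or_true, if_true] at h ⊢
  linarith

theorem averagePair_mem_Wset {n : ℕ} {w : Fin n → ℝ} (hw : w ∈ Wset n) {i j : Fin n}
    (hij : i ≠ j) : averagePair w i j ∈ Wset n := by
  refine ⟨?_, fun k => ?_⟩
  · rw [sum_averagePair (fun _ x => x) w hij]
    linarith [hw.1]
  · have hi := hw.2 i
    have hj := hw.2 j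
    unfold averagePair
    split_ifs
    · positivity
    · exact hw.2 k

/-- Averaging two weights that are in the wrong order does not increase the error at a parameter
whose largest value is the nonnegative target value. -/
theorem MSE_averagePair_le {n : ℕ} {w : Fin n → ℝ} (hw : w ∈ Wset n) {i j : Fin n}
    (hij : i ≠ j) (hwij : w i ≤ w j) {θ : Fin (n + 1) → ℝ} (h0 : 0 ≤ θ 0)
    (hθ : ∀ k, |θ k| ≤ 1 / 2) (hle : ∀ k : Fin n, θ k.succ ≤ θ 0)
    (hθij : θ j.succ ≤ θ i.succ) :
    MSE n (averagePair w i j) θ ≤ MSE n w θ := by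
  have hw' := averagePair_mem_Wset hw hij
  have hb : ∑ k, averagePair w i j k * θ k.succ - θ 0
      ≤ (w i + w j) / 2 * (θ i.succ + θ j.succ) - (w i + w j) * θ 0 := by
    have h1 : ∑ k ∈ {i, j}, averagePair w i j k * (θ 0 - θ k.succ)
        ≤ ∑ k, averagePair w i j k * (θ 0 - θ k.succ) :=
      Finset.sum_le_sum_of_subset_of_nonneg (Finset.subset_univ _)
        fun k _ _ => mul_nonneg (hw'.2 k) (sub_nonneg.2 (hle k))
    rw [Finset.sum_pair hij] at h1
    simp only [mul_sub, Finset.sum_sub_distrib, ← Finset.sum_mul] at h1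
    have h2 := mul_le_mul_of_nonneg_right hw'.1 h0
    have ei : averagePair w i j i = (w i + w j) / 2 := by simp [averagePair]
    have ej : averagePair w i j j = (w i + w j) / 2 := by simp [averagePair]
    rw [ei, ej] at h1
    linarith
  have e1 := sum_averagePair (fun k x => x * θ k.succ) w hij
  have e2 := sum_averagePair (fun k x => x ^ 2 * (1 / 4 - θ k.succ ^ 2)) w hij
  have vi : 0 ≤ 1 / 4 - θ i.succ ^ 2 := by
    have := sq_le_sq' (abs_le.1 (hθ i.succ)).1 (abs_le.1 (hθ i.succ)).2
    linarith
  have vj : 0 ≤ 1 / 4 - θ j.succ ^ 2 := by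
    have := sq_le_sq' (abs_le.1 (hθ j.succ)).1 (abs_le.1 (hθ j.succ)).2
    linarith
  have hi := hw.2 i
  have hj := hw.2 j
  simp only [MSE]
  set B := ∑ k, averagePair w i j k * θ k.succ
  have eB : ∑ k, w k * θ k.succ = B - (w j - w i) / 2 * (θ i.succ - θ j.succ) := by
    rw [e1]; ring
  rw [e2, eB]
  have hs : 0 ≤ (w j - w i) / 2 * (θ i.succ - θ j.succ) :=
    mul_nonneg (by linarith) (by linarith)
  have k1 := mul_le_mul_of_nonneg_left hb hs
  have k2 : 0 ≤ (w j - w i) / 2 * (θ i.succ - θ j.succ) * ((w i + w j) * θ 0) :=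
    mul_nonneg hs (mul_nonneg (by linarith) h0)
  have k3 : 0 ≤ ((w j - w i) / 2) ^ 2
      * ((θ i.succ - θ j.succ) ^ 2 + (1 / 4 - θ i.succ ^ 2) + (1 / 4 - θ j.succ ^ 2)) := by
    positivity
  nlinarith [k1, k2, k3]

theorem sSup_MSE_averagePair_le {E : Type*} [NormedAddCommGroup E] {n : ℕ} {C : ℝ}
    (hC : 0 ≤ C) {R : Fin (n + 1) → E} (hR0 : R 0 = 0) {w : Fin n → ℝ} (hw : w ∈ Wset n)
    {i j : Fin n} (hij : i ≠ j) (hR : ‖R i.succ‖ ≤ ‖R j.succ‖) (hwij : w i ≤ w j) :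
    sSup (MSE n (averagePair w i j) '' ThetaSet n C R) ≤ sSup (MSE n w '' ThetaSet n C R) := by
  have hcont : Continuous (MSE n w) := (continuous_MSE n).comp (Continuous.prodMk_right w)
  refine csSup_le (Set.Nonempty.image _ ⟨_, radialParam_mem_ThetaSet hC R (t := 0) (by norm_num)⟩)
    ?_
  rintro _ ⟨θ, hθ, rfl⟩
  have ht : |θ 0| ≤ 1 / 2 := abs_le.2 (hθ.1 0)
  have hmem := radialParam_mem_ThetaSet hC R ht
  have hzero := radialParam_zero C hR0 (abs_nonneg (θ 0))
  refine (MSE_le_MSE_radialParam hR0 (averagePair_mem_Wset hw hij) hθ).trans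
    ((MSE_averagePair_le hw hij hwij ?_ (fun k => abs_le.2 (hmem.1 k)) (fun k => ?_) ?_).trans
    (le_csSup ((isCompact_ThetaSet n C R).image hcont).bddAbove ⟨_, hmem, rfl⟩))
  · rw [hzero]
    exact abs_nonneg _
  · rw [hzero]
    refine max_le ?_ (by linarith [abs_nonneg (θ 0)])
    linarith [mul_nonneg hC (norm_nonneg (R k.succ))]
  · exact max_le_max (by linarith [mul_le_mul_of_nonneg_left hR hC]) le_rfl

theorem stmt4 {E : Type*} [NormedAddCommGroup E] (n : ℕ) (hn : 1 ≤ n)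
    (C : ℝ) (hC : 0 < C) (R : Fin (n + 1) → E) (hR0 : R 0 = 0)
    (hord : ∀ i j : Fin n, i ≤ j → ‖R i.succ‖ ≤ ‖R j.succ‖) :
    ∃ m : ℝ,
      IsLeast ((fun w => sSup (MSE n w '' ThetaSet n C R)) '' Wset n) m ∧
      IsLeast ((fun w => sSup (MSE n w '' ThetaSet n C R)) ''
        {w ∈ Wset n | ∀ i j : Fin n, i ≤ j → w j ≤ w i}) m := by
  set M : (Fin n → ℝ) → ℝ := fun w => sSup (MSE n w '' ThetaSet n C R)
  have hMcont : Continuous M :=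
    (isCompact_ThetaSet n C R).continuous_sSup (continuous_MSE n)
  obtain ⟨w₀, hw₀, hmin⟩ := (isCompact_Wset n).exists_isMinOn
    ⟨0, by simp, fun _ => le_rfl⟩ hMcont.continuousOn
  have hK : IsCompact (Wset n ∩ {w | M w ≤ M w₀}) :=
    (isCompact_Wset n).inter_right (isClosed_le hMcont continuous_const)
  obtain ⟨w, ⟨hw, hwM⟩, hsq⟩ := hK.exists_isMinOn ⟨w₀, hw₀, le_refl (M w₀)⟩
    (f := fun w => ∑ k, w k ^ 2) (by fun_prop)
  have hmono : ∀ i j : Fin n, i ≤ j → w j ≤ w i := by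
    intro i j hle
    by_contra! hlt
    have hij : i ≠ j := by
      rintro rfl
      exact lt_irrefl _ hlt
    have hM' : M (averagePair w i j) ≤ M w :=
      sSup_MSE_averagePair_le hC.le hR0 hw hij (hord i j hle) hlt.le
    have h : ∑ k, w k ^ 2 ≤ ∑ k, averagePair w i j k ^ 2 :=
      hsq ⟨averagePair_mem_Wset hw hij, hM'.trans hwM⟩
    rw [sum_averagePair (fun _ x => x ^ 2) w hij] at h
    nlinarith [mul_pos (sub_pos.2 hlt) (sub_pos.2 hlt)]
  have hlow : ∀ v ∈ Wset n, M w ≤ M v := fun v hv => le_trans hwM (hmin hv)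
  refine ⟨M w, ⟨⟨w, hw, rfl⟩, ?_⟩, ⟨⟨w, ⟨hw, hmono⟩, rfl⟩, ?_⟩⟩
  · rintro _ ⟨v, hv, rfl⟩
    exact hlow v hv
  · rintro _ ⟨v, hv, rfl⟩
    exact hlow v hv.1
end

section
/- For every w₊ ∈ W₊ and w₋ ∈ W₋, the maximum of MSE_ate(w₊,w₋,θ₊,θ₋) over (θ₊,θ₋) ∈ Θ₊ × Θ₋ equals the maximum over (s,t) ∈ [−1/2, 0] × [0, 1/2] of MSE_ate(w₊, w₋, θ̃₊(s), θ̃₋(t)). -/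
/- STATEMENT 17 (Theorem thm:max_ate): the maximum of MSE_ate over Θ₊ × Θ₋
   equals the maximum over (s,t) ∈ [−1/2,0] × [0,1/2] of
   MSE_ate(w₊, w₋, θ̃₊(s), θ̃₋(t)). -/

open Finset

/-- The bias term b(w,θ) = ∑ wᵢθᵢ − θ₀. -/
noncomputable def bFun (n : ℕ) (w : Fin n → ℝ) (θ : Fin (n + 1) → ℝ) : ℝ :=
  ∑ i, w i * θ i.succ - θ 0

/-- The variance term V(w,θ) = ∑ wᵢ²(1/4 − θᵢ²). -/
noncomputable def vFun (n : ℕ) (w : Fin n → ℝ) (θ : Fin (n + 1) → ℝ) : ℝ :=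
  ∑ i, (w i) ^ 2 * (1 / 4 - (θ i.succ) ^ 2)

/-- The mean squared error of the ATE estimator. -/
noncomputable def MSEate (k m : ℕ) (wp : Fin k → ℝ) (wm : Fin m → ℝ)
    (θp : Fin (k + 1) → ℝ) (θm : Fin (m + 1) → ℝ) : ℝ :=
  (bFun k wp θp) ^ 2 + vFun k wp θp + (bFun m wm θm) ^ 2 + vFun m wm θm -
    2 * bFun k wp θp * bFun m wm θm

/-- The largest parameter vector with value `s` at the boundary point. -/
noncomputable def upperEnvelope {E : Type*} [NormedAddCommGroup E] (n : ℕ) (C : ℝ)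
    (R : Fin (n + 1) → E) (s : ℝ) : Fin (n + 1) → ℝ :=
  fun i => min (s + C * ‖R i‖) (1 / 2)

theorem bFun_neg (n : ℕ) (w : Fin n → ℝ) (θ : Fin (n + 1) → ℝ) :
    bFun n w (-θ) = -bFun n w θ := by
  simp only [bFun, Pi.neg_apply, mul_neg, Finset.sum_neg_distrib]
  ring

theorem vFun_neg (n : ℕ) (w : Fin n → ℝ) (θ : Fin (n + 1) → ℝ) :
    vFun n w (-θ) = vFun n w θ := by
  simp [vFun]

theorem sq_sum_add_mono {ι : Type*} (S : Finset ι) (a δ : ι → ℝ) (B : ℝ)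
    (hδ : ∀ i ∈ S, 0 ≤ δ i) (ha : ∀ i ∈ S, a i ≤ B) :
    B ^ 2 - ∑ i ∈ S, a i ^ 2 ≤ (B + ∑ i ∈ S, δ i) ^ 2 - ∑ i ∈ S, (a i + δ i) ^ 2 := by
  have h1 : ∑ i ∈ S, δ i ^ 2 ≤ (∑ i ∈ S, δ i) ^ 2 := Finset.sum_sq_le_sq_sum_of_nonneg hδ
  have h2 : 0 ≤ ∑ i ∈ S, δ i * (B - a i) :=
    Finset.sum_nonneg fun i hi => mul_nonneg (hδ i hi) (sub_nonneg.2 (ha i hi))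
  have h3 : ∑ i ∈ S, (a i + δ i) ^ 2 =
      ∑ i ∈ S, a i ^ 2 + ∑ i ∈ S, δ i ^ 2 + 2 * B * ∑ i ∈ S, δ i
        - 2 * ∑ i ∈ S, δ i * (B - a i) := by
    simp only [Finset.mul_sum, ← Finset.sum_add_distrib, ← Finset.sum_sub_distrib]
    exact Finset.sum_congr rfl fun i _ => by ring
  rw [h3]
  nlinarith

section Envelope

variable {E : Type*} [NormedAddCommGroup E] {n : ℕ} {C : ℝ} {R : Fin (n + 1) → E}

theorem upperEnvelope_zero (hR0 : R 0 = 0) {s : ℝ} (hs : s ≤ 0) :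
    upperEnvelope n C R s 0 = s := by
  simp only [upperEnvelope, hR0, norm_zero, mul_zero, add_zero]
  exact min_eq_left (by linarith)

theorem le_upperEnvelope (hC : 0 < C) {s : ℝ} (hs : s ≤ 0) (i : Fin (n + 1)) :
    s ≤ upperEnvelope n C R s i := by
  have := mul_nonneg hC.le (norm_nonneg (R i))
  exact le_min (by linarith) (by linarith)

theorem upperEnvelope_mem (hC : 0 < C) {s : ℝ} (hs : s ∈ Set.Icc (-(1 / 2) : ℝ) 0) :
    upperEnvelope n C R s ∈ ThetaSet n C R := by
  refine ⟨fun i => ⟨hs.1.trans (le_upperEnvelope hC hs.2 i), min_le_right _ _⟩, fun i j => ?_⟩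
  refine (abs_min_sub_min_le_max _ _ _ _).trans ?_
  have h : |‖R i‖ - ‖R j‖| ≤ ‖R i - R j‖ := abs_norm_sub_norm_le _ _
  have h0 := mul_nonneg hC.le (norm_nonneg (R i - R j))
  rw [sub_self, abs_zero, add_sub_add_left_eq_sub, ← mul_sub, abs_mul, abs_of_pos hC]
  exact max_le (mul_le_mul_of_nonneg_left h hC.le) h0

theorem neg_mem_ThetaSet {θ : Fin (n + 1) → ℝ} (hθ : θ ∈ ThetaSet n C R) :
    -θ ∈ ThetaSet n C R := by
  refine ⟨fun i => ?_, fun i j => ?_⟩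
  · have := hθ.1 i
    exact ⟨by simpa using neg_le_neg this.2, by simpa using neg_le_neg this.1⟩
  · have := hθ.2 j i
    rw [norm_sub_rev] at this
    simpa [neg_add_eq_sub] using this

theorem bFun_nonneg {w : Fin n → ℝ} (hw : w ∈ Wset n) {x : Fin (n + 1) → ℝ}
    (h0 : x 0 ≤ 0) (hx : ∀ i : Fin n, x 0 ≤ x i.succ) : 0 ≤ bFun n w x := by
  have h : (∑ i, w i) * x 0 ≤ ∑ i, w i * x i.succ := by
    rw [Finset.sum_mul]
    exact Finset.sum_le_sum fun i _ => mul_le_mul_of_nonneg_left (hx i) (hw.2 i)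
  have := hw.1
  unfold bFun
  nlinarith

theorem mul_le_bFun {w : Fin n → ℝ} (hw : w ∈ Wset n) {x : Fin (n + 1) → ℝ}
    (h0 : x 0 ≤ 0) (hx : ∀ i : Fin n, x 0 ≤ x i.succ) (i : Fin n) :
    w i * x i.succ ≤ bFun n w x := by
  have h : ∑ j ∈ univ.erase i, w j * x 0 ≤ ∑ j ∈ univ.erase i, w j * x j.succ :=
    Finset.sum_le_sum fun j _ => mul_le_mul_of_nonneg_left (hx j) (hw.2 j)
  rw [← Finset.sum_mul] at h
  have h1 := Finset.add_sum_erase univ (fun j => w j * x j.succ) (mem_univ i)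
  have h2 := Finset.add_sum_erase univ w (mem_univ i)
  have := hw.1
  have := hw.2 i
  unfold bFun
  nlinarith

/-- Any parameter vector can be replaced by one whose minimum is a nonpositive value at the
boundary point, without decreasing the bias or the variance. -/
theorem exists_normalized (hC : 0 < C) (hR0 : R 0 = 0) {w : Fin n → ℝ} (hw : w ∈ Wset n)
    {θ : Fin (n + 1) → ℝ} (hθ : θ ∈ ThetaSet n C R) :
    ∃ x : Fin (n + 1) → ℝ, x 0 ∈ Set.Icc (-(1 / 2) : ℝ) 0 ∧
      (∀ i : Fin n, x 0 ≤ x i.succ) ∧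
      (∀ i : Fin n, x i.succ ≤ upperEnvelope n C R (x 0) i.succ) ∧
      bFun n w θ ≤ bFun n w x ∧ vFun n w θ ≤ vFun n w x := by
  have hd : ∀ i, |θ i - θ 0| ≤ C * ‖R i‖ := fun i => by simpa [hR0] using hθ.2 i 0
  have hv : ∀ x : Fin (n + 1) → ℝ, (∀ i : Fin n, |x i.succ| ≤ |θ i.succ|) →
      vFun n w θ ≤ vFun n w x := fun x hx =>
    Finset.sum_le_sum fun i _ => mul_le_mul_of_nonneg_left
      (sub_le_sub_left (sq_le_sq.2 (hx i)) _) (sq_nonneg _)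
  rcases le_or_gt (θ 0) 0 with h0 | h0
  · have hle : ∀ i, θ i ≤ upperEnvelope n C R (θ 0) i := fun i =>
      le_min (by linarith [(abs_le.1 (hd i)).2]) (hθ.1 i).2
    refine ⟨Fin.cons (θ 0) fun i => min |θ i.succ| (upperEnvelope n C R (θ 0) i.succ),
      ⟨(hθ.1 0).1, h0⟩, fun i => ?_, fun i => ?_, ?_, hv _ fun i => ?_⟩
    · simp only [Fin.cons_zero, Fin.cons_succ]
      exact le_min (h0.trans (abs_nonneg _)) (le_upperEnvelope hC h0 _)
    · simp only [Fin.cons_zero, Fin.cons_succ]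
      exact min_le_right _ _
    · simp only [bFun, Fin.cons_zero, Fin.cons_succ]
      exact sub_le_sub_right (Finset.sum_le_sum fun i _ => mul_le_mul_of_nonneg_left
        (le_min (le_abs_self _) (hle _)) (hw.2 i)) _
    · simp only [Fin.cons_succ]
      exact abs_le.2 ⟨le_min (by linarith [abs_nonneg (θ i.succ)])
        ((neg_abs_le _).trans (hle _)), min_le_left _ _⟩
  · refine ⟨Fin.cons 0 fun i => max (|θ i.succ| - θ 0) 0,
      ⟨by norm_num, le_rfl⟩, fun i => ?_, fun i => ?_, ?_, hv _ fun i => ?_⟩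
    · simp only [Fin.cons_zero, Fin.cons_succ]
      exact le_max_right _ _
    · simp only [Fin.cons_zero, Fin.cons_succ, upperEnvelope]
      have h1 := abs_le.1 (hd i.succ)
      have h2 := mul_nonneg hC.le (norm_nonneg (R i.succ))
      have h3 : |θ i.succ| ≤ 1 / 2 := abs_le.2 (hθ.1 i.succ)
      refine max_le (le_min ?_ (by linarith)) (le_min (by linarith) (by norm_num))
      rcases abs_cases (θ i.succ) with h | h <;> linarith
    · simp only [bFun, Fin.cons_zero, Fin.cons_succ]
      have h : ∑ i, w i * (θ i.succ - θ 0) ≤ ∑ i, w i * max (|θ i.succ| - θ 0) 0 :=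
        Finset.sum_le_sum fun i _ => mul_le_mul_of_nonneg_left
          ((sub_le_sub_right (le_abs_self _) _).trans (le_max_left _ _)) (hw.2 i)
      simp only [mul_sub, Finset.sum_sub_distrib, ← Finset.sum_mul] at h
      have := hw.1
      nlinarith
    · simp only [Fin.cons_succ]
      rw [abs_of_nonneg (le_max_right _ _)]
      exact max_le (by linarith) (abs_nonneg _)

theorem le_upperEnvelope_objective (hR0 : R 0 = 0) {w : Fin n → ℝ} (hw : w ∈ Wset n)
    {x : Fin (n + 1) → ℝ} (h0 : x 0 ≤ 0) (hx : ∀ i : Fin n, x 0 ≤ x i.succ)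
    (hxM : ∀ i : Fin n, x i.succ ≤ upperEnvelope n C R (x 0) i.succ) {c : ℝ} (hc : 0 ≤ c) :
    (bFun n w x + c) ^ 2 + vFun n w x ≤
      (bFun n w (upperEnvelope n C R (x 0)) + c) ^ 2 +
        vFun n w (upperEnvelope n C R (x 0)) := by
  set M := upperEnvelope n C R (x 0) with hM
  have key := sq_sum_add_mono univ (fun i => w i * x i.succ)
    (fun i => w i * (M i.succ - x i.succ)) (bFun n w x + c)
    (fun i _ => mul_nonneg (hw.2 i) (sub_nonneg.2 (hxM i)))
    (fun i _ => (mul_le_bFun hw h0 hx i).trans (by linarith))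
  have hb : bFun n w x + c + ∑ i, w i * (M i.succ - x i.succ) = bFun n w M + c := by
    simp only [bFun, hM, upperEnvelope_zero hR0 h0, mul_sub, Finset.sum_sub_distrib]
    ring
  have hv : ∀ y : Fin (n + 1) → ℝ,
      vFun n w y = ∑ i, w i ^ 2 * (1 / 4) - ∑ i, (w i * y i.succ) ^ 2 := fun y => by
    rw [vFun, ← Finset.sum_sub_distrib]
    exact Finset.sum_congr rfl fun i _ => by ring
  rw [hb] at key
  simp only [← mul_add, add_sub_cancel] at key
  rw [hv x, hv M]
  linarith

end Envelope

theorem exists_upperEnvelope_ge {E : Type*} [NormedAddCommGroup E] {k m : ℕ} {C : ℝ}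
    (hC : 0 < C) {Rp : Fin (k + 1) → E} {Rm : Fin (m + 1) → E}
    (hRp0 : Rp 0 = 0) (hRm0 : Rm 0 = 0) {wp : Fin k → ℝ} {wm : Fin m → ℝ}
    (hwp : wp ∈ Wset k) (hwm : wm ∈ Wset m)
    {θ : Fin (k + 1) → ℝ} {φ : Fin (m + 1) → ℝ}
    (hθ : θ ∈ ThetaSet k C Rp) (hφ : φ ∈ ThetaSet m C Rm)
    (hb : 0 ≤ bFun k wp θ + bFun m wm φ) :
    ∃ s ∈ Set.Icc (-(1 / 2) : ℝ) 0, ∃ t ∈ Set.Icc (-(1 / 2) : ℝ) 0,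
      (bFun k wp θ + bFun m wm φ) ^ 2 + vFun k wp θ + vFun m wm φ ≤
        (bFun k wp (upperEnvelope k C Rp s) + bFun m wm (upperEnvelope m C Rm t)) ^ 2 +
          vFun k wp (upperEnvelope k C Rp s) + vFun m wm (upperEnvelope m C Rm t) := by
  obtain ⟨x, hx0, hx, hxM, hbx, hvx⟩ := exists_normalized hC hRp0 hwp hθ
  obtain ⟨y, hy0, hy, hyM, hby, hvy⟩ := exists_normalized hC hRm0 hwm hφ
  refine ⟨x 0, hx0, y 0, hy0, ?_⟩
  have h1 := le_upperEnvelope_objective hRp0 hwp hx0.2 hx hxM (bFun_nonneg hwm hy0.2 hy)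
  have hMb : 0 ≤ bFun k wp (upperEnvelope k C Rp (x 0)) := by
    have hM0 := upperEnvelope_zero (C := C) hRp0 hx0.2
    exact bFun_nonneg hwp (hM0.trans_le hx0.2) fun i =>
      hM0.trans_le (le_upperEnvelope hC hx0.2 _)
  have h2 := le_upperEnvelope_objective hRm0 hwm hy0.2 hy hyM hMb
  have h3 : (bFun k wp θ + bFun m wm φ) ^ 2 ≤ (bFun k wp x + bFun m wm y) ^ 2 :=
    pow_le_pow_left₀ hb (add_le_add hbx hby) 2
  rw [add_comm (bFun m wm y), add_comm (bFun m wm _)] at h2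
  linarith

theorem MSEate_neg_right (k m : ℕ) (wp : Fin k → ℝ) (wm : Fin m → ℝ)
    (θ : Fin (k + 1) → ℝ) (φ : Fin (m + 1) → ℝ) :
    MSEate k m wp wm θ (-φ) =
      (bFun k wp θ + bFun m wm φ) ^ 2 + vFun k wp θ + vFun m wm φ := by
  rw [MSEate, bFun_neg, vFun_neg]
  ring

theorem neg_upperEnvelope_neg {E : Type*} [NormedAddCommGroup E] (n : ℕ) (C : ℝ)
    (R : Fin (n + 1) → E) (t : ℝ) :
    -upperEnvelope n C R (-t) = fun i => max (t - C * ‖R i‖) (-(1 / 2)) := by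
  funext i
  rw [Pi.neg_apply, upperEnvelope, ← max_neg_neg]
  congr 1
  ring

theorem exists_MSEate_le {E : Type*} [NormedAddCommGroup E] {k m : ℕ} {C : ℝ}
    (hC : 0 < C) {Rp : Fin (k + 1) → E} {Rm : Fin (m + 1) → E}
    (hRp0 : Rp 0 = 0) (hRm0 : Rm 0 = 0) {wp : Fin k → ℝ} {wm : Fin m → ℝ}
    (hwp : wp ∈ Wset k) (hwm : wm ∈ Wset m)
    {θ : Fin (k + 1) → ℝ} {φ : Fin (m + 1) → ℝ}
    (hθ : θ ∈ ThetaSet k C Rp) (hφ : φ ∈ ThetaSet m C Rm) :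
    ∃ s ∈ Set.Icc (-(1 / 2) : ℝ) 0, ∃ t ∈ Set.Icc (0 : ℝ) (1 / 2),
      MSEate k m wp wm θ φ ≤
        MSEate k m wp wm (upperEnvelope k C Rp s) (-upperEnvelope m C Rm (-t)) := by
  have main : ∀ θ' φ', θ' ∈ ThetaSet k C Rp → φ' ∈ ThetaSet m C Rm →
      0 ≤ bFun k wp θ' + bFun m wm φ' →
      ∃ s ∈ Set.Icc (-(1 / 2) : ℝ) 0, ∃ t ∈ Set.Icc (0 : ℝ) (1 / 2),
        MSEate k m wp wm θ' (-φ') ≤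
          MSEate k m wp wm (upperEnvelope k C Rp s) (-upperEnvelope m C Rm (-t)) := by
    intro θ' φ' hθ' hφ' hb
    obtain ⟨s, hs, t, ht, h⟩ := exists_upperEnvelope_ge hC hRp0 hRm0 hwp hwm hθ' hφ' hb
    refine ⟨s, hs, -t, ⟨by linarith [ht.2], by linarith [ht.1]⟩, ?_⟩
    rwa [MSEate_neg_right, MSEate_neg_right, neg_neg]
  rcases le_total (bFun m wm φ) (bFun k wp θ) with h | h
  · have := main θ (-φ) hθ (neg_mem_ThetaSet hφ) (by rw [bFun_neg]; linarith)
    rwa [neg_neg] at this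
  · have := main (-θ) φ (neg_mem_ThetaSet hθ) hφ (by rw [bFun_neg]; linarith)
    have e : MSEate k m wp wm (-θ) (-φ) = MSEate k m wp wm θ φ := by
      simp only [MSEate, bFun_neg, vFun_neg]
      ring
    rwa [e] at this

theorem stmt17 {E : Type*} [NormedAddCommGroup E] (k m : ℕ) (C : ℝ) (hC : 0 < C)
    (Rp : Fin (k + 1) → E) (Rm : Fin (m + 1) → E)
    (hRp0 : Rp 0 = 0) (hRm0 : Rm 0 = 0)
    (wp : Fin k → ℝ) (wm : Fin m → ℝ)
    (hwp : wp ∈ Wset k) (hwm : wm ∈ Wset m) :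
    ∃ M : ℝ,
      IsGreatest ((fun θ : (Fin (k + 1) → ℝ) × (Fin (m + 1) → ℝ) =>
          MSEate k m wp wm θ.1 θ.2) ''
        ((ThetaSet k C Rp) ×ˢ (ThetaSet m C Rm))) M ∧
      IsGreatest ((fun st : ℝ × ℝ =>
          MSEate k m wp wm (fun i => min (st.1 + C * ‖Rp i‖) (1 / 2))
            (fun i => max (st.2 - C * ‖Rm i‖) (-(1 / 2)))) ''
        ((Set.Icc (-(1 / 2) : ℝ) 0) ×ˢ (Set.Icc (0 : ℝ) (1 / 2)))) M := by
  simp only [← neg_upperEnvelope_neg]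
  change ∃ M : ℝ, _ ∧ IsGreatest ((fun st : ℝ × ℝ => MSEate k m wp wm
    (upperEnvelope k C Rp st.1) (-upperEnvelope m C Rm (-st.2))) '' _) M
  have hcont : Continuous fun st : ℝ × ℝ => MSEate k m wp wm
      (upperEnvelope k C Rp st.1) (-upperEnvelope m C Rm (-st.2)) := by
    simp only [MSEate, bFun, vFun, upperEnvelope, Pi.neg_apply]
    fun_prop
  obtain ⟨M, hM⟩ := ((isCompact_Icc (a := (-(1 / 2) : ℝ)) (b := 0)).prod
    (isCompact_Icc (a := (0 : ℝ)) (b := 1 / 2))).image hcont |>.exists_isGreatest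
    (Set.Nonempty.image _ ⟨(0, 0), by norm_num⟩)
  refine ⟨M, ⟨?_, ?_⟩, hM⟩
  · obtain ⟨⟨s, t⟩, ⟨hs, ht⟩, rfl⟩ := hM.1
    exact ⟨(_, _), ⟨upperEnvelope_mem hC hs, neg_mem_ThetaSet
      (upperEnvelope_mem hC ⟨neg_le_neg ht.2, neg_nonpos.2 ht.1⟩)⟩, rfl⟩
  · rintro _ ⟨⟨θ, φ⟩, ⟨hθ, hφ⟩, rfl⟩
    obtain ⟨s, hs, t, ht, h⟩ := exists_MSEate_le hC hRp0 hRm0 hwp hwm hθ hφ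
    exact h.trans (hM.2 ⟨(s, t), ⟨hs, ht⟩, rfl⟩)
end
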